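/- Let S ⊆ {1,…,m} be a nonempty subset and let f : {-1,+1}^m → {0,1} be an increasing function. Then for every i ∈ S, the Fourier–Walsh coefficients satisfy |f̂_S| ≤ f̂_{{i}}. -/

import Mathlib

open Finset MeasureTheory ProbabilityTheory
open scoped symmDiff

/-- The two-element set `{-1, +1}` of real numbers.  Points of the discrete cube
`{-1,+1}^m` are modelled as functions `Fin m → SignSet`. -/
noncomputable def SignSet : Finset ℝ := {-1, 1}

instance : Nonempty SignSet := ⟨⟨1, by simp [SignSet]⟩⟩

/-- The element `+1` of `{-1,+1}`. -/
noncomputable def sOne : SignSet := ⟨1, by simp [SignSet]⟩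

/-- The element `-1` of `{-1,+1}`. -/
noncomputable def sNegOne : SignSet := ⟨-1, by simp [SignSet]⟩

lemma mul_mem_SignSet {a b : ℝ} (ha : a ∈ SignSet) (hb : b ∈ SignSet) :
    a * b ∈ SignSet := by
  simp only [SignSet, Finset.mem_insert, Finset.mem_singleton] at *
  rcases ha with h | h <;> rcases hb with h' | h' <;> norm_num [h, h']

/-- Coordinatewise product `x·y = (x₁y₁, …, x_m y_m)` of two points of `{-1,+1}^m`. -/
noncomputable def pmul {m : ℕ} (x y : Fin m → SignSet) : Fin m → SignSet :=
  fun i => ⟨(x i : ℝ) * (y i : ℝ), mul_mem_SignSet (x i).2 (y i).2⟩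

/-- Expectation of `f : {-1,+1}^m → ℝ` with respect to the uniform probability
measure `P(B) = |B| / 2^m` on `{-1,+1}^m`. -/
noncomputable def expect {m : ℕ} (f : (Fin m → SignSet) → ℝ) : ℝ :=
  (∑ x : Fin m → SignSet, f x) / 2 ^ m

/-- Expectation of a function on `{-1,+1}^m × {-1,+1}^m` with respect to the uniform
probability measure `P(B) = |B| / 4^m`. -/
noncomputable def expect2 {m : ℕ} (f : (Fin m → SignSet) × (Fin m → SignSet) → ℝ) : ℝ :=
  (∑ p : (Fin m → SignSet) × (Fin m → SignSet), f p) / 4 ^ m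

/-- The uniform probability measure on `{-1,+1}^m`. -/
noncomputable def unifMeasure (m : ℕ) : Measure (Fin m → SignSet) :=
  (PMF.uniformOfFintype (Fin m → SignSet)).toMeasure

/-- The uniform probability measure on `{-1,+1}^m × {-1,+1}^m`. -/
noncomputable def unifMeasure2 (m : ℕ) : Measure ((Fin m → SignSet) × (Fin m → SignSet)) :=
  (PMF.uniformOfFintype ((Fin m → SignSet) × (Fin m → SignSet))).toMeasure

lemma neg_mem_SignSet {a : ℝ} (ha : a ∈ SignSet) : -a ∈ SignSet := by
  simp only [SignSet, Finset.mem_insert, Finset.mem_singleton] at *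
  rcases ha with h | h <;> norm_num [h]

lemma val_cases (a : SignSet) : (a : ℝ) = -1 ∨ (a : ℝ) = 1 := by
  have := a.2
  simpa only [SignSet, Finset.mem_insert, Finset.mem_singleton] using this

/-- Flip the coordinate j. -/
noncomputable def flipAt {m : ℕ} (j : Fin m) (x : Fin m → SignSet) : Fin m → SignSet :=
  Function.update x j ⟨-(x j : ℝ), neg_mem_SignSet (x j).2⟩

lemma flipAt_same {m : ℕ} (j : Fin m) (x : Fin m → SignSet) :
    (flipAt j x j : ℝ) = -(x j : ℝ) := by simp [flipAt]

lemma flipAt_ne {m : ℕ} {j k : Fin m} (h : k ≠ j) (x : Fin m → SignSet) :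
    flipAt j x k = x k := by simp [flipAt, h]

lemma flipAt_invol {m : ℕ} (j : Fin m) : Function.Involutive (flipAt j) := by
  intro x
  funext k
  by_cases h : k = j
  · subst h
    apply Subtype.ext
    rw [flipAt_same, flipAt_same, neg_neg]
  · rw [flipAt_ne h, flipAt_ne h]

lemma sum_flipAt {m : ℕ} (j : Fin m) (g : (Fin m → SignSet) → ℝ) :
    ∑ x, g (flipAt j x) = ∑ x, g x :=
  Equiv.sum_comp (flipAt_invol j).toPerm g

lemma prod_flip_mem {m : ℕ} {j : Fin m} {S : Finset (Fin m)} (h : j ∈ S)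
    (x : Fin m → SignSet) : ∏ k ∈ S, (flipAt j x k : ℝ) = -∏ k ∈ S, (x k : ℝ) := by
  rw [← Finset.mul_prod_erase S _ h, ← Finset.mul_prod_erase S (fun k => (x k : ℝ)) h,
    flipAt_same, neg_mul]
  congr 2
  refine Finset.prod_congr rfl fun k hk => ?_
  rw [flipAt_ne (Finset.ne_of_mem_erase hk)]

lemma prod_flip_not_mem {m : ℕ} {j : Fin m} {S : Finset (Fin m)} (h : j ∉ S)
    (x : Fin m → SignSet) : ∏ k ∈ S, (flipAt j x k : ℝ) = ∏ k ∈ S, (x k : ℝ) := by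
  refine Finset.prod_congr rfl fun k hk => ?_
  rw [flipAt_ne]
  rintro rfl
  exact h hk

lemma abs_chi {m : ℕ} (S : Finset (Fin m)) (x : Fin m → SignSet) :
    |∏ k ∈ S, (x k : ℝ)| = 1 := by
  rw [Finset.abs_prod]
  refine Finset.prod_eq_one fun k _ => ?_
  rcases val_cases (x k) with h | h <;> simp [h]

lemma orth {m : ℕ} {S T : Finset (Fin m)} (h : T ≠ S) :
    ∑ x : Fin m → SignSet, (∏ k ∈ T, (x k : ℝ)) * ∏ k ∈ S, (x k : ℝ) = 0 := by
  obtain ⟨j, hj⟩ : ∃ j, ¬ (j ∈ T ↔ j ∈ S) := by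
    by_contra hh
    push Not at hh
    exact h (Finset.ext hh)
  have := sum_flipAt j (fun x : Fin m → SignSet =>
    (∏ k ∈ T, (x k : ℝ)) * ∏ k ∈ S, (x k : ℝ))
  have h2 : ∀ x : Fin m → SignSet, (∏ k ∈ T, (flipAt j x k : ℝ)) * ∏ k ∈ S, (flipAt j x k : ℝ)
      = - ((∏ k ∈ T, (x k : ℝ)) * ∏ k ∈ S, (x k : ℝ)) := by
    intro x
    by_cases hT : j ∈ T
    · have hS : j ∉ S := by tauto
      rw [prod_flip_mem hT, prod_flip_not_mem hS, neg_mul]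
    · have hS : j ∈ S := by tauto
      rw [prod_flip_mem hS, prod_flip_not_mem hT, mul_neg]
  simp only [h2, Finset.sum_neg_distrib] at this
  linarith

lemma coeff {m : ℕ} (f : (Fin m → SignSet) → ℝ) (c : Finset (Fin m) → ℝ)
    (hc : ∀ x : Fin m → SignSet, f x = ∑ S : Finset (Fin m), c S * ∏ i ∈ S, (x i : ℝ))
    (S : Finset (Fin m)) :
    ∑ x, f x * ∏ k ∈ S, (x k : ℝ) = (Fintype.card (Fin m → SignSet) : ℝ) * c S := by
  simp only [hc, Finset.sum_mul]
  rw [Finset.sum_comm, Finset.sum_eq_single S]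
  · have : ∀ x : Fin m → SignSet,
        c S * (∏ k ∈ S, (x k : ℝ)) * (∏ k ∈ S, (x k : ℝ)) = c S := by
      intro x
      have h := abs_mul_abs_self (∏ k ∈ S, (x k : ℝ))
      rw [abs_chi] at h
      rw [mul_assoc, ← h]
      ring
    simp only [this, Finset.sum_const, Finset.card_univ, nsmul_eq_mul]
  · intro T _ hT
    simp only [mul_assoc]
    rw [← Finset.mul_sum, orth hT, mul_zero]
  · simp

lemma two_sum {m : ℕ} (f : (Fin m → SignSet) → ℝ) {S : Finset (Fin m)} {i : Fin m} (hi : i ∈ S) :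
    2 * ∑ x, f x * ∏ k ∈ S, (x k : ℝ) = ∑ x, (f x - f (flipAt i x)) * ∏ k ∈ S, (x k : ℝ) := by
  have := sum_flipAt i (fun x : Fin m → SignSet => f x * ∏ k ∈ S, (x k : ℝ))
  simp only [prod_flip_mem hi, mul_neg, Finset.sum_neg_distrib] at this
  simp only [sub_mul, Finset.sum_sub_distrib]
  linarith

/-- For an increasing `f : {-1,+1}^m → {0,1}`, a nonempty `S`, and
`i ∈ S`, one has `|f̂_S| ≤ f̂_{{i}}`. -/
theorem statement9 (m : ℕ) (f : (Fin m → SignSet) → ℝ)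
    (hf01 : ∀ x, f x = 0 ∨ f x = 1)
    (hmono : ∀ a b : Fin m → SignSet, (∀ i, (a i : ℝ) ≤ (b i : ℝ)) → f a ≤ f b)
    (c : Finset (Fin m) → ℝ)
    (hc : ∀ x : Fin m → SignSet, f x = ∑ S : Finset (Fin m), c S * ∏ i ∈ S, (x i : ℝ))
    (S : Finset (Fin m)) (hS : S ≠ ∅) (i : Fin m) (hi : i ∈ S) :
    |c S| ≤ c {i} := by
  have hN : (0 : ℝ) < (Fintype.card (Fin m → SignSet) : ℝ) := by
    exact_mod_cast Fintype.card_pos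
  have h1 := two_sum f hi
  have h2 := two_sum f (Finset.mem_singleton_self i)
  rw [coeff f c hc] at h1 h2
  have key : |∑ x, (f x - f (flipAt i x)) * ∏ k ∈ S, (x k : ℝ)|
      ≤ ∑ x, (f x - f (flipAt i x)) * ∏ k ∈ ({i} : Finset (Fin m)), (x k : ℝ) := by
    refine (Finset.abs_sum_le_sum_abs _ _).trans (Finset.sum_le_sum fun x _ => ?_)
    rw [abs_mul, abs_chi, mul_one, Finset.prod_singleton]
    rcases val_cases (x i) with h | h
    · have : f x ≤ f (flipAt i x) := by
        refine hmono _ _ fun k => ?_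
        by_cases hk : k = i
        · subst hk
          rw [flipAt_same, h]; norm_num
        · rw [flipAt_ne hk]
      rw [h, abs_of_nonpos (by linarith)]; linarith
    · have : f (flipAt i x) ≤ f x := by
        refine hmono _ _ fun k => ?_
        by_cases hk : k = i
        · subst hk
          rw [flipAt_same, h]; norm_num
        · rw [flipAt_ne hk]
      rw [h, abs_of_nonneg (by linarith)]; linarith
  rw [← h1, ← h2, abs_mul, abs_mul, abs_of_pos hN, abs_two] at key
  have h3 : (Fintype.card (Fin m → SignSet) : ℝ) * |c S|
      ≤ (Fintype.card (Fin m → SignSet) : ℝ) * c {i} := by linarith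
  exact le_of_mul_le_mul_left h3 hN
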